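/- Fix θ > 0, an integer K ≥ 1, m ∈ ℕ^K and t ≥ 0. Then the explicit death-process transition coefficients sum to one: ∑_{0 ≤ i ≤ m} p_{m, m−i}(t) = 1, where the sum runs over all i ∈ ℕ^K with i ≤ m componentwise. Hence for each t the family {p_{m,n}(t) : 0 ≤ n ≤ m} is a probability distribution, so the prediction operators in Theorems 3.1 and 3.3 map probability laws to finite mixtures with weights summing to one. -/

import Mathlib

open Finset

/-- The death-process rates `λₙ = n(θ + n - 1)/2`. -/
noncomputable def lam (θ : ℝ) (n : ℕ) : ℝ := n * (θ + n - 1) / 2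

/-- The coefficient `C_{M, M - i}(t)`. -/
noncomputable def Ccoef (θ : ℝ) (M i : ℕ) (t : ℝ) : ℝ :=
  (-1 : ℝ) ^ i * ∑ k ∈ Finset.range (i + 1),
    Real.exp (-(lam θ (M - k)) * t) /
      ∏ h ∈ (Finset.range (i + 1)).erase k, (lam θ (M - k) - lam θ (M - h))

/-- The multivariate hypergeometric weight `p(i; m, |i|)`. -/
noncomputable def hyp {K : ℕ} (m i : Fin K → ℕ) : ℝ :=
  ((∑ j, m j).choose (∑ j, i j) : ℝ)⁻¹ * ∏ j, ((m j).choose (i j) : ℝ)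

/-- The explicit death-process transition coefficient `p_{m, m - i}(t)`. -/
noncomputable def pcoef (θ : ℝ) {K : ℕ} (m i : Fin K → ℕ) (t : ℝ) : ℝ :=
  if i = 0 then Real.exp (-(lam θ (∑ j, m j)) * t)
  else Ccoef θ (∑ j, m j) (∑ j, i j) t *
    (∏ h ∈ Finset.range (∑ j, i j), lam θ ((∑ j, m j) - h)) * hyp m i

/-- A generalized Vandermonde identity, tested against a function of the total degree. -/
theorem sum_Iic_prod_choose_mul {ι : Type*} [Fintype ι] [DecidableEq ι] (m : ι → ℕ) (F : ℕ → ℝ) :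
    ∑ i ∈ Finset.Iic m, F (∑ j, i j) * ∏ j, ((m j).choose (i j) : ℝ) =
      ∑ s ∈ Finset.range (∑ j, m j + 1), F s * ((∑ j, m j).choose s : ℝ) := by
  have hIic : Finset.Iic m = Fintype.piFinset fun j => Finset.range (m j + 1) := by
    ext i
    simp [Pi.le_def]
  have hpoly : ((1 : Polynomial ℝ) + Polynomial.X) ^ (∑ j, m j) =
      ∑ i ∈ Finset.Iic m,
        Polynomial.C (∏ j, ((m j).choose (i j) : ℝ)) * Polynomial.X ^ (∑ j, i j) := by
    rw [← Finset.prod_pow_eq_pow_sum, hIic]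
    have h : ∀ j, ((1 : Polynomial ℝ) + Polynomial.X) ^ m j =
        ∑ k ∈ Finset.range (m j + 1),
          Polynomial.C ((m j).choose k : ℝ) * Polynomial.X ^ k := by
      intro j
      rw [add_comm, add_pow]
      refine Finset.sum_congr rfl fun k _ => ?_
      simp [mul_comm]
    simp_rw [h]
    rw [Finset.prod_univ_sum]
    refine Finset.sum_congr rfl fun i _ => ?_
    rw [Finset.prod_mul_distrib, Finset.prod_pow_eq_pow_sum, map_prod]
  have hcoeff : ∀ s, ((∑ j, m j).choose s : ℝ) =
      ∑ i ∈ Finset.Iic m with ∑ j, i j = s, ∏ j, ((m j).choose (i j) : ℝ) := by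
    intro s
    have h := congrArg (fun p => Polynomial.coeff p s) hpoly
    simp only [Polynomial.coeff_one_add_X_pow, Polynomial.finsetSum_coeff,
      Polynomial.coeff_C_mul_X_pow] at h
    rw [h, Finset.sum_filter]
    exact Finset.sum_congr rfl fun i _ => by simp only [eq_comm]
  have hmaps : ∀ i ∈ Finset.Iic m, ∑ j, i j ∈ Finset.range (∑ j, m j + 1) := by
    intro i hi
    rw [Finset.mem_range, Nat.lt_succ_iff]
    exact Finset.sum_le_sum fun j _ => Finset.mem_Iic.1 hi j
  rw [← Finset.sum_fiberwise_of_maps_to hmaps]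
  refine Finset.sum_congr rfl fun s _ => ?_
  rw [hcoeff, Finset.mul_sum]
  refine Finset.sum_congr rfl fun i hi => ?_
  rw [(Finset.mem_filter.1 hi).2]

/-- Newton's form of the interpolation polynomial with nodes `μ 0, …, μ n`, evaluated at `0`,
agrees with Lagrange's form. -/
theorem sum_newton_eq_sum_lagrange_zero (μ e : ℕ → ℝ) (n : ℕ)
    (hμ : ∀ a ≤ n, ∀ b ≤ n, a ≠ b → μ a ≠ μ b) :
    ∑ s ∈ Finset.range (n + 1), ((-1 : ℝ) ^ s * ∑ k ∈ Finset.range (s + 1),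
        e k / ∏ h ∈ (Finset.range (s + 1)).erase k, (μ k - μ h)) * ∏ h ∈ Finset.range s, μ h =
      ∑ k ∈ Finset.range (n + 1),
        e k * ∏ h ∈ (Finset.range (n + 1)).erase k, -μ h / (μ k - μ h) := by
  induction n with
  | zero => simp
  | succ n ih =>
    rw [Finset.sum_range_succ, ih fun a ha b hb => hμ a (by omega) b (by omega)]
    rw [Finset.sum_range_succ _ (n + 1), Finset.sum_range_succ _ (n + 1)]
    have hlast : (Finset.range (n + 1 + 1)).erase (n + 1) = Finset.range (n + 1) := by
      rw [Finset.range_add_one, Finset.erase_insert Finset.notMem_range_self]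
    have hsign : (-1 : ℝ) ^ (n + 1) * ∏ h ∈ Finset.range (n + 1), μ h =
        ∏ h ∈ Finset.range (n + 1), -μ h := by
      rw [Finset.prod_neg, Finset.card_range]
    rw [hlast, mul_right_comm, hsign, mul_add, ← add_assoc]
    congr 1
    · rw [Finset.mul_sum, ← Finset.sum_add_distrib]
      refine Finset.sum_congr rfl fun k hk => ?_
      have hkn : k < n + 1 := Finset.mem_range.1 hk
      have hk_ne : μ k - μ (n + 1) ≠ 0 :=
        sub_ne_zero.2 (hμ k (by omega) (n + 1) le_rfl (by omega))
      have herase : (Finset.range (n + 1 + 1)).erase k =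
          insert (n + 1) ((Finset.range (n + 1)).erase k) := by
        rw [Finset.range_add_one, Finset.erase_insert_of_ne (by omega)]
      have hnot : n + 1 ∉ (Finset.range (n + 1)).erase k := by simp
      have hden : ∏ h ∈ (Finset.range (n + 1)).erase k, (μ k - μ h) ≠ 0 := by
        refine Finset.prod_ne_zero_iff.2 fun h hh => ?_
        rw [Finset.mem_erase, Finset.mem_range] at hh
        exact sub_ne_zero.2 (hμ k (by omega) h (by omega) (Ne.symm hh.1))
      rw [herase, Finset.prod_insert hnot, Finset.prod_insert hnot, Finset.prod_div_distrib,
        ← Finset.mul_prod_erase _ _ hk]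
      field_simp
      ring
    · rw [Finset.prod_div_distrib]
      ring

theorem lam_strictMono {θ : ℝ} (hθ : 0 < θ) : StrictMono (lam θ) := by
  refine strictMono_nat_of_lt_succ fun n => ?_
  have hn : (0 : ℝ) ≤ n := n.cast_nonneg
  unfold lam
  push_cast
  nlinarith

theorem sum_Ccoef_mul_prod_lam {θ : ℝ} (hθ : 0 < θ) (M : ℕ) (t : ℝ) :
    ∑ s ∈ Finset.range (M + 1), Ccoef θ M s t * ∏ h ∈ Finset.range s, lam θ (M - h) = 1 := by
  have hne : ∀ a ≤ M, ∀ b ≤ M, a ≠ b → lam θ (M - a) ≠ lam θ (M - b) := fun a ha b hb hab h => by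
    have := (lam_strictMono hθ).injective h
    omega
  have hzero : lam θ (M - M) = 0 := by simp [lam]
  unfold Ccoef
  rw [sum_newton_eq_sum_lagrange_zero (fun h => lam θ (M - h))
    (fun k => Real.exp (-(lam θ (M - k)) * t)) M hne, Finset.sum_eq_single M]
  · rw [Finset.prod_eq_one, hzero]
    · simp
    · intro h hh
      rw [Finset.mem_erase, Finset.mem_range] at hh
      have := hne h (by omega) M le_rfl hh.1
      rw [hzero] at this ⊢
      rw [zero_sub, div_self (neg_ne_zero.2 this)]
  · intro k _ hk
    rw [Finset.prod_eq_zero (i := M) (by simp [Ne.symm hk]) (by simp [lam]), mul_zero]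
  · simp

theorem pcoef_eq (θ : ℝ) {K : ℕ} (m i : Fin K → ℕ) (t : ℝ) :
    pcoef θ m i t = Ccoef θ (∑ j, m j) (∑ j, i j) t *
      (∏ h ∈ Finset.range (∑ j, i j), lam θ ((∑ j, m j) - h)) * hyp m i := by
  unfold pcoef
  split_ifs with hi
  · subst hi
    simp [Ccoef, hyp]
  · rfl

/-- The explicit death-process transition coefficients sum to one, so the prediction operators in
Theorems 3.1 and 3.3 map probability laws to finite mixtures with weights summing to one. -/
theorem stmt5 (θ : ℝ) (hθ : 0 < θ) (K : ℕ) (hK : 1 ≤ K) (m : Fin K → ℕ)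
    (t : ℝ) (ht : 0 ≤ t) :
    ∑ i ∈ Finset.Iic m, pcoef θ m i t = 1 := by
  simp_rw [pcoef_eq, hyp, ← mul_assoc]
  rw [sum_Iic_prod_choose_mul m fun s => Ccoef θ (∑ j, m j) s t *
    (∏ h ∈ Finset.range s, lam θ ((∑ j, m j) - h)) * ((∑ j, m j).choose s : ℝ)⁻¹,
    ← sum_Ccoef_mul_prod_lam hθ (∑ j, m j) t]
  refine Finset.sum_congr rfl fun s hs => ?_
  have hchoose : ((∑ j, m j).choose s : ℝ) ≠ 0 :=
    Nat.cast_ne_zero.2 (Nat.choose_pos (Nat.lt_succ_iff.1 (Finset.mem_range.1 hs))).ne'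
  rw [inv_mul_cancel_right₀ hchoose]
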